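/- Let a, b ∈ ℚ with b ≠ 0 and a² ≠ 4b², and let C be the genus-2 hyperelliptic curve y² = t⁶ + a t³ + b². Then the rational functions y − t³ − b and y − t³ + b on C have principal divisors divisible by 3 in the divisor group, and the resulting classes (1/3)div(y − t³ − b) and (1/3)div(y − t³ + b) generate a subgroup of Jac(C)(ℚ) isomorphic to (ℤ/3ℤ)². -/

import Mathlib

/-- A place of the smooth projective model of the curve with function field `F` over `ℚ`:
a surjective `ℤ`-valued additive valuation on `F` trivial on the constants `ℚ`. -/
def IsCurvePlace (F : Type) [Field F] [Algebra (RatFunc ℚ) F]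
    (v : AddValuation F (WithTop ℤ)) : Prop :=
  Function.Surjective v ∧ ∀ c : ℚ, c ≠ 0 → v (algebraMap (RatFunc ℚ) F (RatFunc.C c)) = 0

open Polynomial

/-- Places of a field of characteristic zero: normalized discrete valuations trivial on `ℚ`. -/
def Pl (F : Type) [Field F] (v : AddValuation F (WithTop ℤ)) : Prop :=
  Function.Surjective v ∧ ∀ c : ℚ, c ≠ 0 → v (c : F) = 0

open Classical in
/-- additive form of a `ℤᵐ⁰`-valued valuation -/
noncomputable def addOf {F : Type} [Field F] (w : Valuation F (WithZero (Multiplicative ℤ))) :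
    AddValuation F (WithTop ℤ) :=
  AddValuation.of (fun x => if x = 0 then ⊤ else ((-(WithZero.log (w x)) : ℤ) : WithTop ℤ))
    (by simp) (by simp)
    (by
      intro x y
      by_cases hx : x = 0
      · simp [hx]
      by_cases hy : y = 0
      · simp [hy]
      by_cases hxy : x + y = 0
      · simp [hxy]
      simp only [hx, hy, hxy, if_false]
      have hx' : w x ≠ 0 := by simpa using hx
      have hy' : w y ≠ 0 := by simpa using hy
      have hxy' : w (x + y) ≠ 0 := by simpa using hxy
      have h := w.map_add x y
      rw [← WithTop.coe_min, WithTop.coe_le_coe]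
      rcases le_max_iff.1 h with h | h
      · rw [← WithZero.log_le_log hxy' hx'] at h
        exact (min_le_left _ _).trans (neg_le_neg h)
      · rw [← WithZero.log_le_log hxy' hy'] at h
        exact (min_le_right _ _).trans (neg_le_neg h))
    (by
      intro x y
      by_cases hx : x = 0
      · simp [hx]
      by_cases hy : y = 0
      · simp [hy]
      have hx' : w x ≠ 0 := by simpa using hx
      have hy' : w y ≠ 0 := by simpa using hy
      simp only [hx, hy, mul_eq_zero, or_self, if_false, map_mul, WithZero.log_mul hx' hy']
      rw [← WithTop.coe_add]
      congr 1
      ring)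

lemma addOf_apply {F : Type} [Field F] (w : Valuation F (WithZero (Multiplicative ℤ)))
    {x : F} (hx : x ≠ 0) : addOf w x = ((-(WithZero.log (w x)) : ℤ) : WithTop ℤ) := by
  simp [addOf, hx]

lemma addOf_nonneg {F : Type} [Field F] (w : Valuation F (WithZero (Multiplicative ℤ)))
    (x : F) : 0 ≤ addOf w x ↔ w x ≤ 1 := by
  by_cases hx : x = 0
  · simp [hx]
  rw [addOf_apply w hx]
  have hx' : w x ≠ 0 := by simpa using hx
  rw [← WithZero.log_le_log hx' one_ne_zero, WithZero.log_one]
  norm_cast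
  omega

lemma addOf_pos {F : Type} [Field F] (w : Valuation F (WithZero (Multiplicative ℤ)))
    (x : F) : 0 < addOf w x ↔ w x < 1 := by
  by_cases hx : x = 0
  · simp [hx]
  rw [addOf_apply w hx]
  have hx' : w x ≠ 0 := by simpa using hx
  rw [← WithZero.log_lt_log hx' one_ne_zero, WithZero.log_one]
  norm_cast
  omega

lemma addOf_pl {F : Type} [Field F] (w : Valuation F (WithZero (Multiplicative ℤ)))
    (hs : Function.Surjective w) (hc : ∀ c : ℚ, c ≠ 0 → w (c : F) ≤ 1) [CharZero F] :
    Pl F (addOf w) := by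
  refine ⟨?_, ?_⟩
  · intro n
    induction n using WithTop.recTopCoe with
    | top => exact ⟨0, by simp⟩
    | coe n =>
      obtain ⟨x, hx⟩ := hs (WithZero.exp (-n))
      have h0 : x ≠ 0 := by
        rintro rfl
        rw [map_zero] at hx
        exact WithZero.exp_ne_zero hx.symm
      exact ⟨x, by rw [addOf_apply w h0, hx]; simp⟩
  · intro c hc0
    have h0 : (c : F) ≠ 0 := by exact_mod_cast hc0
    have h1 := (addOf_nonneg w _).2 (hc c hc0)
    have h2 := (addOf_nonneg w _).2 (hc c⁻¹ (inv_ne_zero hc0))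
    have h3 : addOf w (c : F) + addOf w ((c⁻¹ : ℚ) : F) = 0 := by
      rw [← AddValuation.map_mul]
      push_cast
      rw [mul_inv_cancel₀ h0, AddValuation.map_one]
    exact ((add_eq_zero_iff_of_nonneg h1 h2).1 h3).1

section Ded
variable {F : Type} [Field F] [CharZero F] [Algebra ℚ[X] F] [Algebra (RatFunc ℚ) F]
  [IsScalarTower ℚ[X] (RatFunc ℚ) F] [FiniteDimensional (RatFunc ℚ) F]

lemma ded_pl [IsDedekindDomain (integralClosure ℚ[X] F)]
    [IsFractionRing (integralClosure ℚ[X] F) F]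
    (w : IsDedekindDomain.HeightOneSpectrum (integralClosure ℚ[X] F)) :
    Pl F (addOf (w.valuation F)) ∧ ∀ x : integralClosure ℚ[X] F, 
      0 ≤ addOf (w.valuation F) (x : F) := by
  have h : ∀ x : integralClosure ℚ[X] F, w.valuation F (x : F) ≤ 1 := fun x => 
    w.valuation_le_one (K := F) x
  refine ⟨addOf_pl _ (w.valuation_surjective F) ?_, fun x => (addOf_nonneg _ _).2 (h x)⟩
  intro c _
  have := h (algebraMap ℚ[X] (integralClosure ℚ[X] F) (C c))
  have e : ((algebraMap ℚ[X] (integralClosure ℚ[X] F) (C c) : integralClosure ℚ[X] F) : F) = c := 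
    eq_ratCast ((algebraMap ℚ[X] F).comp C) c
  rwa [e] at this

lemma ded_integral (h : F) 
    (hh : ∀ v, Pl F v → 0 ≤ v (algebraMap ℚ[X] F X) → 0 ≤ v h) : IsIntegral ℚ[X] h := by
  have : CharZero (RatFunc ℚ) := charZero_of_injective_algebraMap (algebraMap ℚ (RatFunc ℚ)).injective
  have : IsDedekindDomain (integralClosure ℚ[X] F) := 
    integralClosure.isDedekindDomain ℚ[X] (RatFunc ℚ) F
  have : IsFractionRing (integralClosure ℚ[X] F) F :=
    integralClosure.isFractionRing_of_finite_extension (RatFunc ℚ) F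
  have := IsDedekindDomain.HeightOneSpectrum.mem_integers_of_valuation_le_one 
    (R := integralClosure ℚ[X] F) F h ?_
  · obtain ⟨x, rfl⟩ := this
    exact x.2
  · intro w
    obtain ⟨h1, h2⟩ := ded_pl w
    exact (addOf_nonneg _ _).1 (hh _ h1 (h2 (algebraMap ℚ[X] (integralClosure ℚ[X] F) X)))

lemma ded_exists : ∃ v, Pl F v ∧ 0 < v (algebraMap ℚ[X] F X) := by
  have : CharZero (RatFunc ℚ) := charZero_of_injective_algebraMap (algebraMap ℚ (RatFunc ℚ)).injective
  have : IsDedekindDomain (integralClosure ℚ[X] F) := 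
    integralClosure.isDedekindDomain ℚ[X] (RatFunc ℚ) F
  have : IsFractionRing (integralClosure ℚ[X] F) F :=
    integralClosure.isFractionRing_of_finite_extension (RatFunc ℚ) F
  have inj : Function.Injective (algebraMap ℚ[X] F) := by
    rw [IsScalarTower.algebraMap_eq ℚ[X] (RatFunc ℚ) F]
    exact (algebraMap (RatFunc ℚ) F).injective.comp (RatFunc.algebraMap_injective ℚ)
  let x := algebraMap ℚ[X] (integralClosure ℚ[X] F) X
  have hx0 : x ≠ 0 := by
    intro h0
    have : algebraMap ℚ[X] F X = 0 := congrArg Subtype.val h0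
    rw [map_eq_zero_iff _ inj] at this
    exact X_ne_zero this
  have hu : ¬ IsUnit x := by
    intro hu
    obtain ⟨z, hz⟩ := hu.exists_right_inv
    have hz' : algebraMap ℚ[X] F X * (z : F) = 1 := congrArg Subtype.val hz
    have hX : algebraMap (RatFunc ℚ) F (RatFunc.X) = algebraMap ℚ[X] F X := by
      rw [IsScalarTower.algebraMap_apply ℚ[X] (RatFunc ℚ) F, RatFunc.algebraMap_X]
    have hzz : (z : F) = algebraMap (RatFunc ℚ) F (RatFunc.X)⁻¹ := by
      rw [map_inv₀, hX]
      exact eq_inv_of_mul_eq_one_right hz'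
    have hi : IsIntegral ℚ[X] (z : F) := z.2
    rw [hzz, isIntegral_algebraMap_iff (algebraMap (RatFunc ℚ) F).injective] at hi
    obtain ⟨p, hp⟩ := IsIntegrallyClosed.isIntegral_iff.1 hi
    have : (algebraMap ℚ[X] (RatFunc ℚ)) (X * p) = algebraMap ℚ[X] (RatFunc ℚ) 1 := by
      rw [map_mul, hp, RatFunc.algebraMap_X, map_one, mul_inv_cancel₀ RatFunc.X_ne_zero]
    exact not_isUnit_X (IsUnit.of_mul_eq_one _ (RatFunc.algebraMap_injective ℚ this))
  obtain ⟨M, hM, hxM⟩ := exists_max_ideal_of_mem_nonunits hu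
  let w : IsDedekindDomain.HeightOneSpectrum (integralClosure ℚ[X] F) := 
    ⟨M, hM.isPrime, fun h => hx0 (by simpa [h] using hxM)⟩
  refine ⟨_, (ded_pl w).1, (addOf_pos _ _).2 ?_⟩
  exact (w.valuation_lt_one_iff_mem (K := F) x).2 hxM
end Ded

section Ord
variable {F : Type} [Field F]

/-- integer order of vanishing, with the convention `ord 0 = 0`. -/
noncomputable def ordv (v : AddValuation F (WithTop ℤ)) (x : F) : ℤ := (v x).untopD 0

variable (v : AddValuation F (WithTop ℤ))

lemma ordv_spec {x : F} (hx : x ≠ 0) : v x = (ordv v x : WithTop ℤ) := by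
  have := v.ne_top_iff.2 hx
  unfold ordv
  obtain ⟨n, hn⟩ := WithTop.ne_top_iff_exists.1 this
  rw [← hn]
  simp

lemma ordv_eq {x : F} {n : ℤ} (h : v x = (n : WithTop ℤ)) : ordv v x = n := by
  simp [ordv, h]

lemma ordv_zero : ordv v 0 = 0 := by simp [ordv]

lemma ordv_nonneg {x : F} : 0 ≤ v x ↔ 0 ≤ ordv v x := by
  by_cases hx : x = 0
  · simp [hx, ordv_zero]
  · rw [ordv_spec v hx]
    norm_cast

lemma ordv_pos {x : F} (hx : x ≠ 0) : 0 < v x ↔ 0 < ordv v x := by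
  rw [ordv_spec v hx]
  norm_cast

lemma ordv_mul {x y : F} (hx : x ≠ 0) (hy : y ≠ 0) : ordv v (x * y) = ordv v x + ordv v y := by
  apply ordv_eq
  rw [AddValuation.map_mul, ordv_spec v hx, ordv_spec v hy]
  norm_cast

lemma ordv_one : ordv v 1 = 0 := by simp [ordv]

lemma ordv_neg (x : F) : ordv v (-x) = ordv v x := by simp [ordv, AddValuation.map_neg]

lemma ordv_pow (x : F) (n : ℕ) : ordv v (x ^ n) = n * ordv v x := by
  by_cases hx : x = 0
  · subst hx
    rcases n with _ | n <;> simp [ordv_zero, ordv_one]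
  induction n with
  | zero => simp [ordv_one]
  | succ n ih =>
    rw [pow_succ, ordv_mul v (pow_ne_zero _ hx) hx, ih]
    push_cast
    ring

lemma ordv_inv (x : F) : ordv v x⁻¹ = - ordv v x := by
  by_cases hx : x = 0
  · simp [hx, ordv_zero]
  have := ordv_mul v hx (inv_ne_zero hx)
  rw [mul_inv_cancel₀ hx, ordv_one] at this
  omega

lemma ordv_zpow (x : F) (n : ℤ) : ordv v (x ^ n) = n * ordv v x := by
  cases n with
  | ofNat n => simpa using ordv_pow v x n
  | negSucc n => 
    rw [zpow_negSucc, ordv_inv, ordv_pow]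
    rw [Int.negSucc_eq]
    push_cast
    ring

lemma ordv_add_le {x y : F} {n : ℤ} (hn : n ≤ 0) (hx : n ≤ ordv v x) (hy : n ≤ ordv v y) :
    n ≤ ordv v (x + y) := by
  by_cases h0 : x + y = 0
  · rw [h0, ordv_zero]
    exact hn
  have key : ∀ z : F, n ≤ ordv v z → (n : WithTop ℤ) ≤ v z := by
    intro z hz
    by_cases hz0 : z = 0
    · simp [hz0]
    · rw [ordv_spec v hz0]
      exact_mod_cast hz
  have := v.map_le_add (key x hx) (key y hy)
  rw [ordv_spec v h0] at this
  exact_mod_cast this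

lemma ordv_add_min {x y : F} {n : ℤ} (hx0 : x ≠ 0) (hy0 : y ≠ 0) (h0 : x + y ≠ 0)
    (hx : n ≤ ordv v x) (hy : n ≤ ordv v y) :
    n ≤ ordv v (x + y) := by
  have key : ∀ z : F, z ≠ 0 → n ≤ ordv v z → (n : WithTop ℤ) ≤ v z := by
    intro z hz0 hz
    rw [ordv_spec v hz0]
    exact_mod_cast hz
  have := v.map_le_add (key x hx0 hx) (key y hy0 hy)
  rw [ordv_spec v h0] at this
  exact_mod_cast this

lemma ordv_add_lt {x y : F} (hx0 : x ≠ 0) (hy0 : y ≠ 0) (h : ordv v x < ordv v y) :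
    ordv v (x + y) = ordv v x := by
  apply ordv_eq
  rw [← ordv_spec v hx0]
  apply v.map_add_eq_of_lt_left
  rw [ordv_spec v hx0, ordv_spec v hy0]
  exact_mod_cast h

lemma ordv_add_ne {x y : F} (hx0 : x ≠ 0) (hy0 : y ≠ 0) (h : ordv v x ≠ ordv v y) :
    ordv v (x + y) = min (ordv v x) (ordv v y) := by
  rcases lt_or_gt_of_ne h with h | h
  · rw [ordv_add_lt v hx0 hy0 h, min_eq_left h.le]
  · rw [add_comm, ordv_add_lt v hy0 hx0 h, min_eq_right h.le]

variable {v}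
lemma Pl.ordv_const (hv : Pl F v) (c : ℚ) : ordv v (c : F) = 0 := by
  by_cases hc : c = 0
  · simp [hc, ordv_zero]
  · simp [ordv, hv.2 c hc]

variable [CharZero F]
lemma Pl.poly_nonneg (hv : Pl F v) {t : F} (ht : 0 ≤ ordv v t) (p : ℚ[X]) :
    0 ≤ ordv v (aeval t p) := by
  induction p using Polynomial.induction_on with
  | C c => simp [hv.ordv_const]
  | add p q hp hq => 
    rw [map_add]
    exact ordv_add_le v le_rfl hp hq
  | monomial n c h =>
    rw [← ordv_nonneg] at *
    rw [pow_succ, ← mul_assoc, map_mul, AddValuation.map_mul, aeval_X]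
    exact add_nonneg h ht

lemma Pl.poly_unit (hv : Pl F v) {t : F} (ht : 0 < ordv v t) (p : ℚ[X]) (hp : p.coeff 0 ≠ 0) :
    ordv v (aeval t p) = 0 := by
  have ht0 : t ≠ 0 := by
    rintro rfl
    simp [ordv_zero] at ht
  have e : aeval t p = ((p.coeff 0 : ℚ) : F) + aeval t p.divX * t := by
    conv_lhs => rw [← Polynomial.divX_mul_X_add p]
    simp [add_comm]
  have hc : ((p.coeff 0 : ℚ) : F) ≠ 0 := by exact_mod_cast hp
  rw [e]
  by_cases h0 : aeval t p.divX = 0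
  · rw [h0]
    simpa using hv.ordv_const _
  rw [ordv_add_lt v hc (mul_ne_zero h0 ht0), hv.ordv_const]
  rw [hv.ordv_const, ordv_mul v h0 ht0]
  have := hv.poly_nonneg ht.le p.divX
  omega

lemma poly_order {t : F} (p : ℚ[X]) (hp : p ≠ 0) :
    ∃ k : ℤ, ∀ v, Pl F v → 0 < ordv v t → ordv v (aeval t p) = k * ordv v t := by
  obtain ⟨q, hq, hq'⟩ := exists_eq_pow_rootMultiplicity_mul_and_not_dvd p hp 0
  rw [map_zero, sub_zero] at hq hq'
  rw [X_dvd_iff] at hq'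
  refine ⟨rootMultiplicity 0 p, ?_⟩
  intro v hv ht
  have ht0 : t ≠ 0 := by
    rintro rfl
    simp [ordv_zero] at ht
  have h1 := hv.poly_unit ht q hq'
  generalize rootMultiplicity 0 p = k at *
  rw [hq, map_mul, map_pow, aeval_X]
  by_cases h0 : aeval t q = 0
  · exfalso
    have e : aeval t q = ((q.coeff 0 : ℚ) : F) + aeval t q.divX * t := by
      conv_lhs => rw [← Polynomial.divX_mul_X_add q]
      simp [add_comm]
    rw [h0] at e
    have e2 : aeval t q.divX * t = ((-q.coeff 0 : ℚ) : F) := by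
      push_cast
      linear_combination -e
    have hne : ((-q.coeff 0 : ℚ) : F) ≠ 0 := by
      exact_mod_cast neg_ne_zero.2 hq'
    have h3 := hv.ordv_const (-q.coeff 0)
    rw [← e2] at h3 hne
    rw [ordv_mul v (left_ne_zero_of_mul hne) ht0] at h3
    have := hv.poly_nonneg ht.le q.divX
    omega
  rw [ordv_mul v (pow_ne_zero _ ht0) h0, ordv_pow, h1, add_zero]

lemma Pl.poly_inf (hv : Pl F v) {t : F} (ht : ordv v t < 0) (p : ℚ[X])  (hp : p ≠ 0) 
    (hp' : aeval t p ≠ 0) :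
    ordv v (aeval t p) = p.natDegree * ordv v t := by
  have ht0 : t ≠ 0 := by
    rintro rfl
    simp [ordv_zero] at ht
  let : Invertible t := invertibleOfNonzero ht0
  have h := eval₂_reverse_mul_pow (algebraMap ℚ F) t p
  rw [← aeval_def, ← aeval_def, invOf_eq_inv] at h
  have h0 : aeval t⁻¹ p.reverse ≠ 0 := by
    intro h0
    rw [h0, zero_mul] at h
    exact hp' h.symm
  rw [← h, ordv_mul v h0 (pow_ne_zero _ ht0), ordv_pow, hv.poly_unit (by rw [ordv_inv]; omega), zero_add]
  rw [coeff_zero_reverse]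
  exact leadingCoeff_ne_zero.2 hp
end Ord

/-- `F` is the function field of the curve `y² = f(t)` over `ℚ`. -/
structure QC (F : Type) [Field F] [CharZero F] (t y : F) (f : ℚ[X]) : Prop where
  inj : ∀ p : ℚ[X], aeval t p = 0 → p = 0
  eq : y ^ 2 = aeval t f
  gen : ∀ g : F, ∃ D A B : ℚ[X], D ≠ 0 ∧ aeval t D * g = aeval t A + aeval t B * y
  sig : ∃ σ : F →+* F, σ t = t ∧ σ y = -y

section QCs
variable {F : Type} [Field F] [CharZero F] {t y : F} {f : ℚ[X]}

lemma QC.dedAux (H : QC F t y f) :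
    (∃ v, Pl F v ∧ 0 < v t) ∧
    (∀ g : F, (∀ v, Pl F v → 0 ≤ v t → 0 ≤ v g) →
      (∃ D A : ℚ[X], D ≠ 0 ∧ aeval t D * g = aeval t A) → ∃ p : ℚ[X], g = aeval t p) := by
  have hφ : nonZeroDivisors ℚ[X] ≤ (nonZeroDivisors F).comap (aeval t : ℚ[X] →ₐ[ℚ] F).toRingHom := by
    intro p hp
    simp only [Submonoid.mem_comap, mem_nonZeroDivisors_iff_ne_zero] at *
    exact fun h => hp (H.inj p h)
  let i1 : Algebra ℚ[X] F := (aeval t : ℚ[X] →ₐ[ℚ] F).toRingHom.toAlgebra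
  let i2 : Algebra (RatFunc ℚ) F := (RatFunc.liftRingHom _ hφ).toAlgebra
  have ha : ∀ p, algebraMap ℚ[X] F p = aeval t p := fun p => rfl
  have i3 : IsScalarTower ℚ[X] (RatFunc ℚ) F := IsScalarTower.of_algebraMap_eq fun p => 
    (RatFunc.liftRingHom_algebraMap _ hφ p).symm
  have hb : ∀ p, algebraMap (RatFunc ℚ) F (algebraMap ℚ[X] (RatFunc ℚ) p) = aeval t p := by
    intro p
    rw [← IsScalarTower.algebraMap_apply, ha]
  have i4 : FiniteDimensional (RatFunc ℚ) F := by
    classical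
    refine ⟨⟨{1, y}, ?_⟩⟩
    rw [eq_top_iff]
    intro g _
    obtain ⟨D, A, B, hD, h⟩ := H.gen g
    have hD' : aeval t D ≠ 0 := fun h => hD (H.inj D h)
    have e : g = (algebraMap ℚ[X] (RatFunc ℚ) A / algebraMap ℚ[X] (RatFunc ℚ) D) • (1 : F) 
       + (algebraMap ℚ[X] (RatFunc ℚ) B / algebraMap ℚ[X] (RatFunc ℚ) D) • y := by
      rw [Algebra.smul_def, Algebra.smul_def, map_div₀, map_div₀, hb, hb, hb]
      field_simp
      linear_combination h
    rw [e]
    apply Submodule.add_mem <;> apply Submodule.smul_mem <;> apply Submodule.subset_span <;> simp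
  refine ⟨?_, ?_⟩
  · obtain ⟨v, hv, h⟩ := ded_exists (F := F)
    exact ⟨v, hv, by simpa [ha] using h⟩
  · rintro g hg ⟨D, A, hD, hDA⟩
    have := ded_integral g (by simpa [ha] using hg)
    have hD' : aeval t D ≠ 0 := fun h => hD (H.inj D h)
    have e : g = algebraMap (RatFunc ℚ) F (algebraMap ℚ[X] (RatFunc ℚ) A / algebraMap ℚ[X] (RatFunc ℚ) D) := by
      rw [map_div₀, hb, hb]
      field_simp
      linear_combination hDA
    rw [e, isIntegral_algebraMap_iff (algebraMap (RatFunc ℚ) F).injective] at this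
    obtain ⟨p, hp⟩ := IsIntegrallyClosed.isIntegral_iff.1 this
    exact ⟨p, by rw [e, ← hp, hb]⟩

lemma QC.t_ne (H : QC F t y f) : t ≠ 0 := by
  intro h
  have := H.inj X (by simpa using h)
  exact X_ne_zero this

lemma QC.exists_place (H : QC F t y f) : ∃ v, Pl F v ∧ 0 < ordv v t := by
  obtain ⟨v, hv, h⟩ := H.dedAux.1
  exact ⟨v, hv, (ordv_pos v H.t_ne).1 h⟩

lemma QC.isPoly (H : QC F t y f) (g : F) (hg : ∀ v, Pl F v → 0 ≤ ordv v t → 0 ≤ ordv v g)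
    (h : ∃ D A : ℚ[X], D ≠ 0 ∧ aeval t D * g = aeval t A) : ∃ p : ℚ[X], g = aeval t p :=
  H.dedAux.2 g (fun v hv ht => (ordv_nonneg v).2 (hg v hv ((ordv_nonneg v).1 ht))) h

lemma sig_poly (σ : F →+* F) (ht : σ t = t) (p : ℚ[X]) : σ (aeval t p) = aeval t p := by
  rw [aeval_def, hom_eval₂, ht]
  congr 1
  exact RingHom.ext fun x => by simp

lemma QC.sig_sig (H : QC F t y f) (σ : F →+* F) (ht : σ t = t) (hy : σ y = -y) (g : F) : 
    σ (σ g) = g := by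
  obtain ⟨D, A, B, hD, h⟩ := H.gen g
  have hD' : aeval t D ≠ 0 := fun h => hD (H.inj D h)
  have h2 := congrArg σ (congrArg σ h)
  simp only [map_mul, map_add, sig_poly σ ht, hy, map_neg, neg_neg] at h2
  rw [← h] at h2
  exact mul_left_cancel₀ hD' h2

lemma QC.comap_pl (H : QC F t y f) (σ : F →+* F) (ht : σ t = t) (hy : σ y = -y)
    {v} (hv : Pl F v) : Pl F (v.comap σ) := by
  refine ⟨?_, ?_⟩
  · intro n
    obtain ⟨x, hx⟩ := hv.1 n
    refine ⟨σ x, ?_⟩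
    change v (σ (σ x)) = n
    rw [H.sig_sig σ ht hy, hx]
  · intro c hc
    change v (σ c) = 0
    rw [map_ratCast]
    exact hv.2 c hc

lemma ordv_comap (v : AddValuation F (WithTop ℤ)) (σ : F →+* F) (x : F) :
    ordv (v.comap σ) x = ordv v (σ x) := rfl

end QCs

section QC3
variable {F : Type} [Field F] [CharZero F] {t y : F} {f : ℚ[X]}

lemma rev_eval {t : F} (ht : t ≠ 0) (p : ℚ[X]) : 
    aeval t⁻¹ p.reverse = aeval t p * t⁻¹ ^ p.natDegree := by
  let _ : Invertible t := invertibleOfNonzero ht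
  have h := eval₂_reverse_mul_pow (algebraMap ℚ F) t p
  rw [← aeval_def, ← aeval_def, invOf_eq_inv] at h
  rw [← h, mul_assoc, ← mul_pow, mul_inv_cancel₀ ht, one_pow, mul_one]

lemma QC.inv {a b : ℚ} (H : QC F t y (X ^ 6 + C a * X ^ 3 + C (b ^ 2))) :
    QC F t⁻¹ (y * t⁻¹ ^ 3) (C (b ^ 2) * X ^ 6 + C a * X ^ 3 + 1) := by
  have ht := H.t_ne
  refine ⟨?_, ?_, ?_, ?_⟩
  · intro p hp
    have := rev_eval (inv_ne_zero ht) p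
    rw [inv_inv, hp, zero_mul] at this
    simpa using H.inj _ this
  · have := H.eq
    simp only [map_add, map_mul, map_pow, aeval_X, aeval_C, map_one] at this ⊢
    rw [mul_pow, this]
    field_simp
    ring
  · intro g
    obtain ⟨D, A, B, hD, h⟩ := H.gen g
    refine ⟨D.reverse * X ^ (A.natDegree + B.natDegree + 3), 
      A.reverse * X ^ (D.natDegree + B.natDegree + 3), B.reverse * X ^ (D.natDegree + A.natDegree), ?_, ?_⟩
    · exact mul_ne_zero (by simpa using hD) (pow_ne_zero _ X_ne_zero)
    · simp only [map_mul, map_pow, aeval_X, rev_eval ht]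
      generalize t⁻¹ = s
      linear_combination h * s ^ (D.natDegree + A.natDegree + B.natDegree + 3)
  · obtain ⟨σ, h1, h2⟩ := H.sig
    exact ⟨σ, by rw [map_inv₀, h1], by rw [map_mul, map_pow, map_inv₀, h1, h2, neg_mul]⟩

lemma val_unit {c : ℚ} {v} (hv : Pl F v) (ht0 : t ≠ 0) (ht : 0 < ordv v t) 
    (hy : 0 < v (y - (c : F))) (A B : ℚ[X]) (h : A.coeff 0 + B.coeff 0 * c ≠ 0) :
    v (aeval t A + aeval t B * y) = 0 := by
  have e : ∀ p : ℚ[X], aeval t p = ((p.coeff 0 : ℚ) : F) + aeval t p.divX * t := by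
    intro p
    conv_lhs => rw [← Polynomial.divX_mul_X_add p]
    simp [add_comm]
  have e2 : aeval t A + aeval t B * y = ((A.coeff 0 + B.coeff 0 * c : ℚ) : F) + 
      (t * (aeval t A.divX + aeval t B.divX * y) + ((B.coeff 0 : ℚ) : F) * (y - c)) := by
    rw [e A, e B]
    push_cast
    ring
  have hcn : ∀ c : ℚ, 0 ≤ v (c : F) := fun c => (ordv_nonneg v).2 (hv.ordv_const c).ge
  have hy0 : 0 ≤ v y := by
    have := v.map_le_add hy.le (hcn c)
    simpa using this
  have htv := (ordv_pos v ht0).2 ht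
  have hp : ∀ p : ℚ[X], 0 ≤ v (aeval t p) := fun p => (ordv_nonneg v).2 (hv.poly_nonneg ht.le p)
  rw [e2, v.map_add_eq_of_lt_left, hv.2 _ h]
  rw [hv.2 _ h]
  apply v.map_lt_add
  · rw [AddValuation.map_mul]
    refine lt_of_lt_of_le htv (le_add_of_nonneg_right (v.map_le_add (hp _) ?_))
    rw [AddValuation.map_mul]
    exact add_nonneg (hp _) hy0
  · rw [AddValuation.map_mul]
    exact lt_of_lt_of_le hy (le_add_of_nonneg_left (hcn _))

lemma QC.order_aux0 (H : QC F t y f) {c : ℚ} (hc : c ≠ 0) (A B : ℚ[X])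
    (hAB : ¬ (A.coeff 0 = 0 ∧ B.coeff 0 = 0)) (h0 : aeval t A + aeval t B * y ≠ 0) :
    ∃ k : ℤ, ∀ v, Pl F v → 0 < ordv v t → 0 < v (y - (c : F)) → 
      ordv v (aeval t A + aeval t B * y) = k * ordv v t := by
  by_cases h1 : A.coeff 0 + B.coeff 0 * c = 0
  · have h2 : A.coeff 0 + (-B).coeff 0 * c ≠ 0 := by
      intro h2
      rw [coeff_neg] at h2
      apply hAB
      have hA : A.coeff 0 = 0 := by linarith
      refine ⟨hA, ?_⟩
      rw [hA, zero_add] at h1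
      exact (mul_eq_zero.1 h1).resolve_right hc
    have hN : (aeval t A + aeval t B * y) * (aeval t A + aeval t (-B) * y) = aeval t (A ^ 2 - B ^ 2 * f) := by
      simp only [map_mul, map_sub, map_pow, map_neg, ← H.eq]
      ring
    by_cases hz : aeval t A + aeval t (-B) * y = 0
    · refine ⟨0, fun v hv ht hy => ?_⟩
      have := val_unit hv H.t_ne ht hy A (-B) h2
      rw [hz] at this
      simp at this
    · obtain ⟨k, hk⟩ := poly_order (t := t) (A ^ 2 - B ^ 2 * f) (by
        intro hp
        rw [hp, map_zero] at hN
        exact mul_ne_zero h0 hz hN)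
      refine ⟨k, fun v hv ht hy => ?_⟩
      have h3 := val_unit hv H.t_ne ht hy A (-B) h2
      have h4 : ordv v (aeval t A + aeval t (-B) * y) = 0 := ordv_eq v (by rw [h3]; rfl)
      rw [← hk v hv ht, ← hN, ordv_mul v h0 hz, h4, add_zero]
  · refine ⟨0, fun v hv ht hy => ?_⟩
    rw [zero_mul]
    exact ordv_eq v (by simpa using val_unit hv H.t_ne ht hy A B h1)

lemma QC.order_aux (H : QC F t y f) {c : ℚ} (hc : c ≠ 0) (n : ℕ) : ∀ A B : ℚ[X], 
    A.natDegree ≤ n → B.natDegree ≤ n → aeval t A + aeval t B * y ≠ 0 →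
    ∃ k : ℤ, ∀ v, Pl F v → 0 < ordv v t → 0 < v (y - (c : F)) → 
      ordv v (aeval t A + aeval t B * y) = k * ordv v t := by
  have ht := H.t_ne
  induction n with
  | zero =>
    intro A B hA hB h0
    apply H.order_aux0 hc A B _ h0
    rintro ⟨h1, h2⟩
    apply h0
    rw [eq_C_of_natDegree_le_zero hA, eq_C_of_natDegree_le_zero hB, h1, h2]
    simp
  | succ n ih =>
    intro A B hA hB h0
    by_cases hAB : A.coeff 0 = 0 ∧ B.coeff 0 = 0
    · have e : ∀ p : ℚ[X], p.coeff 0 = 0 → aeval t p = aeval t p.divX * t := by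
        intro p hp
        conv_lhs => rw [← Polynomial.divX_mul_X_add p]
        simp [hp]
      have e2 : aeval t A + aeval t B * y = (aeval t A.divX + aeval t B.divX * y) * t := by
        rw [e A hAB.1, e B hAB.2]
        ring
      rw [e2] at h0 ⊢
      have h00 := left_ne_zero_of_mul h0
      obtain ⟨k, hk⟩ := ih A.divX B.divX (by rw [natDegree_divX_eq_natDegree_tsub_one]; omega) 
        (by rw [natDegree_divX_eq_natDegree_tsub_one]; omega) h00
      refine ⟨k + 1, fun v hv h1 h2 => ?_⟩
      rw [ordv_mul v h00 ht, hk v hv h1 h2]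
      ring
    · exact H.order_aux0 hc A B hAB h0

lemma QC.order (H : QC F t y f) {c : ℚ} (hc : c ≠ 0) (g : F) (hg : g ≠ 0) : 
    ∃ k : ℤ, ∀ v, Pl F v → 0 < ordv v t → 0 < v (y - (c : F)) → 
      ordv v g = k * ordv v t := by
  obtain ⟨D, A, B, hD, h⟩ := H.gen g
  have hD' : aeval t D ≠ 0 := fun h => hD (H.inj D h)
  have h0 : aeval t A + aeval t B * y ≠ 0 := by
    rw [← h]
    exact mul_ne_zero hD' hg
  obtain ⟨k, hk⟩ := H.order_aux hc (max A.natDegree B.natDegree) A B (le_max_left _ _) (le_max_right _ _) h0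
  obtain ⟨l, hl⟩ := poly_order (t := t) D hD
  refine ⟨k - l, fun v hv h1 h2 => ?_⟩
  have e1 := hk v hv h1 h2
  rw [← h, ordv_mul v hD' hg, hl v hv h1] at e1
  linear_combination e1

lemma QC.unique (H : QC F t y f) {c : ℚ} (hc : c ≠ 0) :
    {v | Pl F v ∧ 0 < ordv v t ∧ 0 < v (y - (c : F))}.Subsingleton := by
  have key : ∀ v, Pl F v → 0 < ordv v t → 0 < v (y - (c : F)) → ordv v t = 1 := by
    intro v hv h1 h2
    obtain ⟨g, hg⟩ := hv.1 ((1 : ℤ) : WithTop ℤ)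
    have hg0 : g ≠ 0 := by
      rintro rfl
      simp at hg
    obtain ⟨k, hk⟩ := H.order hc g hg0
    have := hk v hv h1 h2
    rw [ordv_eq v hg] at this
    exact Int.eq_one_of_mul_eq_one_left h1.le this.symm
  rintro v ⟨hv, h1, h2⟩ w ⟨hw, h3, h4⟩
  apply AddValuation.ext
  intro g
  by_cases hg : g = 0
  · simp [hg]
  obtain ⟨k, hk⟩ := H.order hc g hg
  rw [ordv_spec v hg, ordv_spec w hg, hk v hv h1 h2, hk w hw h3 h4, key v hv h1 h2, key w hw h3 h4]

lemma QC.finite (H : QC F t y f) {c : ℚ} (hc : c ≠ 0) (hf : f.coeff 0 = c ^ 2) :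
    {v | Pl F v ∧ 0 < ordv v t}.Finite := by
  refine ((H.unique hc).finite.union (H.unique (neg_ne_zero.2 hc)).finite).subset ?_
  rintro v ⟨hv, h1⟩
  have ht := H.t_ne
  have e : (y - (c : F)) * (y - ((-c : ℚ) : F)) = aeval t f.divX * t := by
    have h2 : aeval t f = aeval t f.divX * t + ((c : F)) ^ 2 := by
      conv_lhs => rw [← Polynomial.divX_mul_X_add f]
      simp [hf]
    push_cast
    linear_combination H.eq + h2
  by_contra hcon
  simp only [Set.mem_union, Set.mem_ofPred_eq, hv, h1, true_and, not_or, not_lt] at hcon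
  have h3 := congrArg v e
  rw [AddValuation.map_mul, AddValuation.map_mul] at h3
  have h4 : (0 : WithTop ℤ) < v (aeval t f.divX) + v t := 
    lt_of_lt_of_le ((ordv_pos v ht).2 h1)
      (le_add_of_nonneg_left ((ordv_nonneg v).2 (hv.poly_nonneg h1.le _)))
  rw [← h3] at h4
  exact absurd h4 (not_lt.2 (add_nonpos hcon.1 hcon.2))

lemma sq_dvd_aux {f D B q : ℚ[X]} (hf : Squarefree f) (hD : D ≠ 0) (h : D ^ 2 * q = B ^ 2 * f) : D ∣ B := by
  obtain ⟨d, e, hde, h1, h2⟩ : ∃ d e : ℚ[X], IsCoprime d e ∧ D = EuclideanDomain.gcd D B * d ∧ B = EuclideanDomain.gcd D B * e := by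
    obtain ⟨d, hd⟩ := EuclideanDomain.gcd_dvd_left D B
    obtain ⟨e, he⟩ := EuclideanDomain.gcd_dvd_right D B
    refine ⟨d, e, ?_, hd, he⟩
    have h0 : EuclideanDomain.gcd D B ≠ 0 := by
      intro h0
      rw [h0, zero_mul] at hd
      exact hD hd
    have hb := EuclideanDomain.gcd_eq_gcd_ab D B
    refine ⟨EuclideanDomain.gcdA D B, EuclideanDomain.gcdB D B, mul_left_cancel₀ h0 ?_⟩
    generalize EuclideanDomain.gcdA D B = x at *
    generalize EuclideanDomain.gcdB D B = z at *
    generalize EuclideanDomain.gcd D B = g at *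
    rw [hd, he] at hb
    linear_combination -hb
  generalize EuclideanDomain.gcd D B = g at *
  have hg : g ≠ 0 := by
    rintro rfl
    rw [zero_mul] at h1
    exact hD h1
  have h3 : d ^ 2 * q = e ^ 2 * f := by
    apply mul_left_cancel₀ (pow_ne_zero 2 hg)
    rw [h1, h2] at h
    linear_combination h
  have h4 : d * d ∣ f := by
    rw [← sq]
    exact (hde.pow (m := 2) (n := 2)).dvd_of_dvd_mul_left ⟨q, h3.symm⟩
  have := hf d h4
  rw [h1, h2]
  exact mul_dvd_mul_left g (this.dvd)

lemma QC.main (H : QC F t y f) (hf : Squarefree f) (hdeg : f.natDegree = 6)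
    (hinf : ∃ v, Pl F v ∧ ordv v t < 0)
    (h : F) (h1 : ∀ v, Pl F v → 0 ≤ ordv v t → 0 ≤ ordv v h)
    (h2 : ∀ v, Pl F v → ordv v t < 0 → 2 * ordv v t ≤ ordv v h) (σ : F →+* F) (ht : σ t = t) (hy : σ y = -y) : 
    σ h = h := by
  obtain ⟨D, A, B, hD, hAB⟩ := H.gen h
  have hD' : aeval t D ≠ 0 := fun h => hD (H.inj D h)
  have hAB2 := congrArg σ hAB
  simp only [map_mul, map_add, sig_poly σ ht, hy] at hAB2
  have hd : aeval t D * (h - σ h) = 2 * aeval t B * y := by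
    linear_combination hAB - hAB2
  have hd2 : aeval t (D ^ 2) * (h - σ h) ^ 2 = aeval t ((C 2 * B) ^ 2 * f) := by
    simp only [map_mul, map_pow, aeval_C, ← H.eq]
    have : (algebraMap ℚ F) 2 = 2 := by simp
    rw [this]
    linear_combination (aeval t D * (h - σ h) + 2 * aeval t B * y) * hd
  obtain ⟨q, hq⟩ := H.isPoly ((h - σ h) ^ 2) (by
    intro v hv h0
    rw [ordv_pow]
    have e1 := h1 v hv h0
    have e2 := h1 _ (H.comap_pl σ ht hy hv) (by rw [ordv_comap, ht]; exact h0)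
    rw [ordv_comap] at e2
    rw [sub_eq_add_neg]
    have := ordv_add_le v le_rfl e1 (ordv_neg v (σ h) ▸ e2)
    push_cast
    omega) ⟨_, _, pow_ne_zero 2 hD, hd2⟩
  by_contra hne
  have hne' : h - σ h ≠ 0 := fun h0 => hne (by linear_combination -h0)
  rw [hq, ← map_mul] at hd2
  have hpol : D ^ 2 * q = (C 2 * B) ^ 2 * f := by
    have := H.inj (D ^ 2 * q - (C 2 * B) ^ 2 * f) (by rw [map_sub, hd2, sub_self])
    linear_combination this
  obtain ⟨e, he⟩ := sq_dvd_aux hf hD hpol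
  rw [he] at hpol
  have hqe : q = e ^ 2 * f := by
    apply mul_left_cancel₀ (pow_ne_zero 2 hD)
    linear_combination hpol
  have hq0 : aeval t q ≠ 0 := hq ▸ pow_ne_zero 2 hne'
  have hq00 : q ≠ 0 := by
    rintro rfl
    simp at hq0
  have hqd : 6 ≤ q.natDegree := by
    have he0 : e ≠ 0 := by
      rintro rfl
      simp [hqe] at hq00
    rw [hqe, natDegree_mul (pow_ne_zero 2 he0) hf.ne_zero, hdeg]
    omega
  obtain ⟨v, hv, hvt⟩ := hinf
  have e0 := hv.poly_inf hvt q hq00 hq0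
  rw [← hq, ordv_pow] at e0
  have e1 := h2 v hv hvt
  have e2 := h2 _ (H.comap_pl σ ht hy hv) (by rw [ordv_comap, ht]; exact hvt)
  rw [ordv_comap, ordv_comap, ht] at e2
  have e3 := ordv_add_le v (by omega) e1 (ordv_neg v (σ h) ▸ e2)
  rw [← sub_eq_add_neg] at e3
  have : (6 : ℤ) ≤ q.natDegree := by exact_mod_cast hqd
  push_cast at e0
  nlinarith

end QC3

section Orders
variable {F : Type} [Field F] [CharZero F] {t y : F}

lemma ord_u {a b : ℚ} (hb : b ≠ 0) (hab : a - 2 * b ≠ 0) (ht0 : t ≠ 0)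
    (hy : y ^ 2 = t ^ 6 + a * t ^ 3 + (b : F) ^ 2) {v} (hv : Pl F v) :
    y - (t ^ 3 + b) ≠ 0 ∧ y + (t ^ 3 + b) ≠ 0 ∧
    ordv v (y - (t ^ 3 + b)) + ordv v (y + (t ^ 3 + b)) = 3 * ordv v t ∧
    (ordv v (y - (t ^ 3 + b)) = 0 ∨ ordv v (y - (t ^ 3 + b)) = 3 * ordv v t) := by
  have e : (y - (t ^ 3 + b)) * (y + (t ^ 3 + b)) = ((a - 2 * b : ℚ) : F) * t ^ 3 := by
    push_cast
    linear_combination hy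
  have hc : ((a - 2 * b : ℚ) : F) ≠ 0 := by exact_mod_cast hab
  have hne : (y - (t ^ 3 + b)) * (y + (t ^ 3 + b)) ≠ 0 := by
    rw [e]
    exact mul_ne_zero hc (pow_ne_zero _ ht0)
  have hu := left_ne_zero_of_mul hne
  have hw := right_ne_zero_of_mul hne
  have hsum : ordv v (y - (t ^ 3 + b)) + ordv v (y + (t ^ 3 + b)) = 3 * ordv v t := by
    rw [← ordv_mul v hu hw, e, ordv_mul v hc (pow_ne_zero _ ht0), hv.ordv_const, ordv_pow]
    push_cast
    ring
  refine ⟨hu, hw, hsum, ?_⟩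
  have hd : (y + (t ^ 3 + b)) + -(y - (t ^ 3 + b)) = ((2 : ℚ) : F) * t ^ 3 + ((2 * b : ℚ) : F) := by
    push_cast
    ring
  have h2 : ((2 : ℚ) : F) * t ^ 3 ≠ 0 := mul_ne_zero (by norm_num) (pow_ne_zero _ ht0)
  have h2b : ((2 * b : ℚ) : F) ≠ 0 := by
    have : 2 * b ≠ 0 := by simpa using hb
    exact_mod_cast this
  have o2 : ordv v (((2 : ℚ) : F) * t ^ 3) = 3 * ordv v t := by
    rw [ordv_mul v (by norm_num) (pow_ne_zero _ ht0), hv.ordv_const, ordv_pow]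
    push_cast
    ring
  have o2b := hv.ordv_const (2 * b)
  have hnu := neg_ne_zero.2 hu
  have onu := ordv_neg v (y - (t ^ 3 + b))
  have hint : 0 ≤ ordv v t → 0 ≤ ordv v (y - (t ^ 3 + b)) ∧ 0 ≤ ordv v (y + (t ^ 3 + b)) := by
    intro h0
    have hb0 : 0 ≤ ordv v (t ^ 3 + b) := by
      apply ordv_add_le v le_rfl
      · rw [ordv_pow]
        positivity
      · rw [hv.ordv_const]
    have hy0 : 0 ≤ ordv v y := by
      have h1 : 0 ≤ ordv v (y ^ 2) := by
        have := hv.poly_nonneg h0 (X ^ 6 + C a * X ^ 3 + C b ^ 2)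
        rw [hy]
        simpa using this
      rw [ordv_pow] at h1
      push_cast at h1
      omega
    refine ⟨?_, ordv_add_le v le_rfl hy0 hb0⟩
    rw [sub_eq_add_neg]
    exact ordv_add_le v le_rfl hy0 (by rwa [ordv_neg])
  rcases lt_trichotomy (ordv v t) 0 with h | h | h
  · have od := ordv_add_lt v h2 h2b (by omega)
    have hd0 : (y + (t ^ 3 + b)) + -(y - (t ^ 3 + b)) ≠ 0 := by
      intro h0
      rw [← hd, h0, ordv_zero] at od
      omega
    by_cases hq : ordv v (y + (t ^ 3 + b)) = ordv v (-(y - (t ^ 3 + b)))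
    · have := ordv_add_min v hw hnu hd0 le_rfl hq.le
      rw [hd] at this
      omega
    · have := ordv_add_ne v hw hnu hq
      rw [hd] at this
      omega
  · have := hint h.ge
    omega
  · have hi := hint h.le
    have od := ordv_add_lt v h2b h2 (by omega)
    rw [add_comm] at od
    by_contra hcon
    have hd0 : (y + (t ^ 3 + b)) + -(y - (t ^ 3 + b)) ≠ 0 := by
      rw [hd]
      intro h0
      have e1 : ((2 : ℚ) : F) * t ^ 3 = -((2 * b : ℚ) : F) := by linear_combination h0
      rw [e1, ordv_neg] at o2
      omega
    have := ordv_add_min (n := 1) v hw hnu hd0 (by omega) (by omega)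
    rw [hd] at this
    omega

lemma ord_joint {a b : ℚ} (hb : b ≠ 0) (hab : a - 2 * b ≠ 0) (hab' : a + 2 * b ≠ 0) (ht0 : t ≠ 0)
    (hy : y ^ 2 = t ^ 6 + a * t ^ 3 + (b : F) ^ 2) {v} (hv : Pl F v) :
    y - (t ^ 3 + b) ≠ 0 ∧ y - (t ^ 3 - b) ≠ 0 ∧
    (ordv v (y - (t ^ 3 + b)) = 0 ∨ ordv v (y - (t ^ 3 + b)) = 3 * ordv v t) ∧
    (ordv v (y - (t ^ 3 - b)) = 0 ∨ ordv v (y - (t ^ 3 - b)) = 3 * ordv v t) ∧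
    (0 < ordv v t → ordv v (y - (t ^ 3 + b)) ≠ ordv v (y - (t ^ 3 - b))) ∧
    (ordv v t < 0 → ordv v (y - (t ^ 3 + b)) = ordv v (y - (t ^ 3 - b))) ∧
    ordv v (-y - (t ^ 3 + b)) = 3 * ordv v t - ordv v (y - (t ^ 3 + b)) ∧
    ordv v (-y - (t ^ 3 - b)) = 3 * ordv v t - ordv v (y - (t ^ 3 - b)) := by
  obtain ⟨h1, h2, h3, h4⟩ := ord_u hb hab ht0 hy hv
  obtain ⟨k1, k2, k3, k4⟩ := ord_u (y := y) (a := a) (b := -b) (neg_ne_zero.2 hb) (by simpa using hab') ht0 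
    (by push_cast; linear_combination hy) hv
  push_cast at k1 k2 k3 k4
  rw [← sub_eq_add_neg] at k1 k2 k3 k4
  have h2b : ((2 * b : ℚ) : F) ≠ 0 := by
    have : 2 * b ≠ 0 := by simpa using hb
    exact_mod_cast this
  have o2b := hv.ordv_const (F := F) (2 * b)
  have e1 : (y - (t ^ 3 - b)) + -(y - (t ^ 3 + b)) = ((2 * b : ℚ) : F) := by
    push_cast
    ring
  have e2 : (y + (t ^ 3 + b)) + -(y + (t ^ 3 - b)) = ((2 * b : ℚ) : F) := by
    push_cast
    ring
  have s1 : -y - (t ^ 3 + b) = -(y + (t ^ 3 + b)) := by ring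
  have s2 : -y - (t ^ 3 - b) = -(y + (t ^ 3 - b)) := by ring
  rw [s1, s2, ordv_neg, ordv_neg]
  have n1 := ordv_neg v (y - (t ^ 3 + b))
  have n2 := ordv_neg v (y + (t ^ 3 - b))
  refine ⟨h1, k1, h4, k4, ?_, ?_, by omega, by omega⟩
  · intro hT heq
    have m1 := ordv_add_min (n := 1) v k1 (neg_ne_zero.2 h1) (by rw [e1]; exact h2b)
    have m2 := ordv_add_min (n := 1) v h2 (neg_ne_zero.2 k2) (by rw [e2]; exact h2b)
    rw [e1, o2b, n1] at m1
    rw [e2, o2b, n2] at m2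
    omega
  · intro hT
    by_contra hne
    have m1 := ordv_add_ne v k1 (neg_ne_zero.2 h1) (by omega)
    rw [e1, o2b, n1] at m1
    omega

lemma core {f : ℚ[X]} (H : QC F t y f) (hf : Squarefree f) (hdeg : f.natDegree = 6)
    (hinf : ∃ v, Pl F v ∧ ordv v t < 0) 
    {a b : ℚ} (hb : b ≠ 0) (hab : a - 2 * b ≠ 0) (hab' : a + 2 * b ≠ 0)
    (hy : y ^ 2 = t ^ 6 + a * t ^ 3 + (b : F) ^ 2) (g : F) (hg : g ≠ 0) (r s : ℤ) 
    (hrs : (r = 1 ∧ s = 0) ∨ (r = 0 ∧ s = 1) ∨ (r = 1 ∧ s = 1) ∨ (r = 1 ∧ s = -1))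
    (h : ∀ v, Pl F v → 3 * ordv v g = r * ordv v (y - (t ^ 3 + b)) + s * ordv v (y - (t ^ 3 - b))) : 
    False := by
  have ht0 := H.t_ne
  obtain ⟨σ, st, sy⟩ := H.sig
  have J := fun v (hv : Pl F v) => ord_joint hb hab hab' ht0 hy hv
  have su1 : σ (y - (t ^ 3 + b)) = -y - (t ^ 3 + b) := by simp [st, sy]
  have su2 : σ (y - (t ^ 3 - b)) = -y - (t ^ 3 - b) := by simp [st, sy]
  -- orders after conjugation
  have hσ : ∀ v, Pl F v → 3 * ordv v (σ g) = r * (3 * ordv v t - ordv v (y - (t ^ 3 + b))) 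
      + s * (3 * ordv v t - ordv v (y - (t ^ 3 - b))) := by
    intro v hv
    have := h _ (H.comap_pl σ st sy hv)
    rw [ordv_comap, ordv_comap, ordv_comap, su1, su2] at this
    obtain ⟨-, -, -, -, -, -, j1, j2⟩ := J v hv
    rw [this, j1, j2]
  obtain ⟨v0, hv0, hT0⟩ := H.exists_place
  obtain ⟨v1, hv1, hT1⟩ := hinf
  by_cases hcase : r = 1 ∧ s = -1
  · obtain ⟨rfl, rfl⟩ := hcase
    have hfix := H.main hf hdeg ⟨v1, hv1, hT1⟩ (t * g) (by
      intro v hv hT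
      rw [ordv_mul v ht0 hg]
      obtain ⟨-, -, j1, j2, -, -, -, -⟩ := J v hv
      have := h v hv
      omega) (by
      intro v hv hT
      rw [ordv_mul v ht0 hg]
      obtain ⟨-, -, j1, j2, -, -, -, -⟩ := J v hv
      have := h v hv
      omega) σ st sy
    have hfg : σ g = g := by
      rw [map_mul, st] at hfix
      exact mul_left_cancel₀ ht0 hfix
    have a1 := h v0 hv0
    have a2 := hσ v0 hv0
    rw [hfg] at a2
    obtain ⟨-, -, j1, j2, j3, -, -, -⟩ := J v0 hv0
    have := j3 hT0
    omega
  · have hfg := H.main hf hdeg ⟨v1, hv1, hT1⟩ g (by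
      intro v hv hT
      obtain ⟨-, -, j1, j2, -, -, -, -⟩ := J v hv
      have := h v hv
      rcases hrs with ⟨rfl, rfl⟩ | ⟨rfl, rfl⟩ | ⟨rfl, rfl⟩ | ⟨rfl, rfl⟩ <;> omega) (by
      intro v hv hT
      obtain ⟨-, -, j1, j2, -, -, -, -⟩ := J v hv
      have := h v hv
      rcases hrs with ⟨rfl, rfl⟩ | ⟨rfl, rfl⟩ | ⟨rfl, rfl⟩ | ⟨rfl, rfl⟩ <;> omega) σ st sy
    have a1 := h v1 hv1
    have a2 := hσ v1 hv1
    rw [hfg] at a2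
    obtain ⟨-, -, j1, j2, -, j3, -, -⟩ := J v1 hv1
    have := j3 hT1
    rcases hrs with ⟨rfl, rfl⟩ | ⟨rfl, rfl⟩ | ⟨rfl, rfl⟩ | ⟨rfl, rfl⟩ <;> omega

lemma core2 {f : ℚ[X]} (H : QC F t y f) (hf : Squarefree f) (hdeg : f.natDegree = 6)
    (hinf : ∃ v, Pl F v ∧ ordv v t < 0) 
    {a b : ℚ} (hb : b ≠ 0) (hab : a - 2 * b ≠ 0) (hab' : a + 2 * b ≠ 0)
    (hy : y ^ 2 = t ^ 6 + a * t ^ 3 + (b : F) ^ 2) (g : F) (hg : g ≠ 0) (m n : ℤ) 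
    (h : ∀ v, Pl F v → 3 * ordv v g = m * ordv v (y - (t ^ 3 + b)) + n * ordv v (y - (t ^ 3 - b))) : 
    3 ∣ m ∧ 3 ∣ n := by
  obtain ⟨v1, hv1, hT1⟩ := hinf
  obtain ⟨u1, u2, -⟩ := ord_joint hb hab hab' H.t_ne hy hv1
  let g' := g * ((y - (t ^ 3 + b)) ^ ((m + 1) / 3) * (y - (t ^ 3 - b)) ^ ((n + 1) / 3))⁻¹
  have hp : (y - (t ^ 3 + b)) ^ ((m + 1) / 3) * (y - (t ^ 3 - b)) ^ ((n + 1) / 3) ≠ 0 :=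
    mul_ne_zero (zpow_ne_zero _ u1) (zpow_ne_zero _ u2)
  have hg' : g' ≠ 0 := mul_ne_zero hg (inv_ne_zero hp)
  have key : ∀ v, Pl F v → 3 * ordv v g' = (m - 3 * ((m + 1) / 3)) * ordv v (y - (t ^ 3 + b)) 
      + (n - 3 * ((n + 1) / 3)) * ordv v (y - (t ^ 3 - b)) := by
    intro v hv
    rw [ordv_mul v hg (inv_ne_zero hp), ordv_inv, ordv_mul v (zpow_ne_zero _ u1) (zpow_ne_zero _ u2), 
      ordv_zpow, ordv_zpow]
    linear_combination h v hv
  obtain ⟨r, hr⟩ : ∃ r, r = m - 3 * ((m + 1) / 3) := ⟨_, rfl⟩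
  obtain ⟨s, hs⟩ : ∃ s, s = n - 3 * ((n + 1) / 3) := ⟨_, rfl⟩
  rw [← hr, ← hs] at key
  by_contra hcon
  by_cases hcase : (r = 1 ∧ s = 0) ∨ (r = 0 ∧ s = 1) ∨ (r = 1 ∧ s = 1) ∨ (r = 1 ∧ s = -1)
  · exact core H hf hdeg ⟨v1, hv1, hT1⟩ hb hab hab' hy g' hg' r s hcase key
  · refine core H hf hdeg ⟨v1, hv1, hT1⟩ hb hab hab' hy g'⁻¹ (inv_ne_zero hg') (-r) (-s) (by omega) ?_
    intro v hv
    rw [ordv_inv]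
    linear_combination - key v hv
end Orders

section Final

lemma f_deg (a b : ℚ) : (X ^ 6 + C a * X ^ 3 + C (b ^ 2) : ℚ[X]).natDegree = 6 := by
  compute_degree!

lemma f_sqfree {a b : ℚ} (hb : b ≠ 0) (hab : a ^ 2 ≠ 4 * b ^ 2) :
    Squarefree (X ^ 6 + C a * X ^ 3 + C (b ^ 2) : ℚ[X]) := by
  apply Polynomial.Separable.squarefree
  have hd : derivative (X ^ 6 + C a * X ^ 3 + C (b ^ 2) : ℚ[X]) = X ^ 2 * (C 3 * (C 2 * X ^ 3 + C a)) := by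
    simp only [derivative_add, derivative_mul, derivative_X_pow, derivative_C]
    simp only [map_ofNat, Nat.cast_ofNat]
    ring
  rw [Polynomial.Separable, hd]
  have c1 : IsCoprime (X ^ 6 + C a * X ^ 3 + C (b ^ 2) : ℚ[X]) X := by
    refine ⟨C ((b ^ 2)⁻¹), -C ((b ^ 2)⁻¹) * (X ^ 5 + C a * X ^ 2), ?_⟩
    have : (C ((b ^ 2)⁻¹) * C (b ^ 2) : ℚ[X]) = 1 := by
      rw [← C_mul, inv_mul_cancel₀ (pow_ne_zero 2 hb), C_1]
    linear_combination this
  have c2 : IsCoprime (X ^ 6 + C a * X ^ 3 + C (b ^ 2) : ℚ[X]) (C 2 * X ^ 3 + C a) := by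
    have hδ : 4 * b ^ 2 - a ^ 2 ≠ 0 := fun h => hab (by linear_combination -h)
    refine ⟨C ((4 * b ^ 2 - a ^ 2)⁻¹) * 4, -C ((4 * b ^ 2 - a ^ 2)⁻¹) * (C 2 * X ^ 3 + C a), ?_⟩
    have : (C ((4 * b ^ 2 - a ^ 2)⁻¹) * (4 * C (b ^ 2) - C a ^ 2) : ℚ[X]) = 1 := by
      have h4 : (4 * C (b ^ 2) - C a ^ 2 : ℚ[X]) = C (4 * b ^ 2 - a ^ 2) := by
        simp only [map_sub, map_mul, map_pow, map_ofNat]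
      rw [h4, ← C_mul, inv_mul_cancel₀ hδ, C_1]
    simp only [map_ofNat]
    linear_combination this
  refine c1.pow_right.mul_right (IsCoprime.mul_right ?_ c2)
  have hu : IsUnit (C (3 : ℚ)) := isUnit_C.2 (by norm_num)
  obtain ⟨z, hz⟩ := hu.exists_left_inv
  exact ⟨0, z, by rw [hz]; ring⟩

lemma f_nonsq {a b : ℚ} (hb : b ≠ 0) (hab : a ^ 2 ≠ 4 * b ^ 2) (r : RatFunc ℚ) :
    r ^ 2 ≠ algebraMap ℚ[X] (RatFunc ℚ) (X ^ 6 + C a * X ^ 3 + C (b ^ 2)) := by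
  intro h
  have hi : IsIntegral ℚ[X] r := by
    apply IsIntegral.of_pow (n := 2) (by norm_num)
    rw [h]
    exact isIntegral_algebraMap
  obtain ⟨p, rfl⟩ := IsIntegrallyClosed.isIntegral_iff.1 hi
  rw [← map_pow] at h
  have h2 := RatFunc.algebraMap_injective ℚ h
  have hu := f_sqfree hb hab p (by rw [← h2, sq])
  have hd := f_deg a b
  rw [← h2, natDegree_pow, natDegree_eq_zero_of_isUnit hu] at hd
  omega

variable {F : Type} [Field F] [Algebra (RatFunc ℚ) F]

lemma aeval_alg [CharZero F] (p : ℚ[X]) : aeval (algebraMap (RatFunc ℚ) F RatFunc.X) p = 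
    algebraMap (RatFunc ℚ) F (algebraMap ℚ[X] (RatFunc ℚ) p) := by
  have : (aeval (algebraMap (RatFunc ℚ) F RatFunc.X) : ℚ[X] →ₐ[ℚ] F).toRingHom =
     (algebraMap (RatFunc ℚ) F).comp (algebraMap ℚ[X] (RatFunc ℚ)) := by
    apply Polynomial.ringHom_ext
    · intro c
      exact (eq_ratCast (((aeval (algebraMap (RatFunc ℚ) F RatFunc.X) : ℚ[X] →ₐ[ℚ] F).toRingHom).comp C) c).trans
        (eq_ratCast (((algebraMap (RatFunc ℚ) F).comp (algebraMap ℚ[X] (RatFunc ℚ))).comp C) c).symm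
    · simp
  exact RingHom.congr_fun this p

lemma mkQC [CharZero F] {a b : ℚ} (hb : b ≠ 0) (hab : a ^ 2 ≠ 4 * b ^ 2) (y : F)
    (hy : y ^ 2 = algebraMap (RatFunc ℚ) F
      (algebraMap ℚ[X] (RatFunc ℚ) (X ^ 6 + C a * X ^ 3 + C (b ^ 2))))
    (hgen : Algebra.adjoin (RatFunc ℚ) {y} = ⊤) :
    QC F (algebraMap (RatFunc ℚ) F RatFunc.X) y (X ^ 6 + C a * X ^ 3 + C (b ^ 2)) := by
  have hnsq := f_nonsq hb hab
  generalize (X ^ 6 + C a * X ^ 3 + C (b ^ 2) : ℚ[X]) = f at *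
  have gen : ∀ g : F, ∃ A B : RatFunc ℚ, g = algebraMap _ F A + algebraMap _ F B * y := by
    intro g
    have hg : g ∈ Algebra.adjoin (RatFunc ℚ) {y} := by
      rw [hgen]
      trivial
    induction hg using Algebra.adjoin_induction with
    | mem x hx =>
      rw [Set.mem_singleton_iff] at hx
      exact ⟨0, 1, by simp [hx]⟩
    | algebraMap r => exact ⟨r, 0, by simp⟩
    | add x z _ _ h1 h2 =>
      obtain ⟨A, B, rfl⟩ := h1
      obtain ⟨A', B', rfl⟩ := h2
      exact ⟨A + A', B + B', by simp only [map_add]; ring⟩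
    | mul x z _ _ h1 h2 =>
      obtain ⟨A, B, rfl⟩ := h1
      obtain ⟨A', B', rfl⟩ := h2
      refine ⟨A * A' + B * B' * algebraMap ℚ[X] (RatFunc ℚ) f, A * B' + A' * B, ?_⟩
      simp only [map_add, map_mul, ← hy]
      ring
  refine ⟨?_, ?_, ?_, ?_⟩
  · intro p hp
    rw [aeval_alg, map_eq_zero] at hp
    exact (map_eq_zero_iff _ (RatFunc.algebraMap_injective ℚ)).1 hp
  · rw [hy, aeval_alg]
  · intro g
    obtain ⟨A, B, rfl⟩ := gen g
    refine ⟨A.denom * B.denom, A.num * B.denom, B.num * A.denom, 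
      mul_ne_zero A.denom_ne_zero B.denom_ne_zero, ?_⟩
    have hA : algebraMap ℚ[X] (RatFunc ℚ) A.denom * A = algebraMap ℚ[X] (RatFunc ℚ) A.num := by
      conv_lhs => rw [← RatFunc.num_div_denom A]
      rw [RatFunc.num_div_denom A]
      conv_lhs => arg 2; rw [← RatFunc.num_div_denom A]
      exact mul_div_cancel₀ _ (RatFunc.algebraMap_ne_zero A.denom_ne_zero)
    have hB : algebraMap ℚ[X] (RatFunc ℚ) B.denom * B = algebraMap ℚ[X] (RatFunc ℚ) B.num := by
      conv_lhs => arg 2; rw [← RatFunc.num_div_denom B]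
      exact mul_div_cancel₀ _ (RatFunc.algebraMap_ne_zero B.denom_ne_zero)
    simp only [aeval_alg, map_mul]
    rw [← hA, ← hB]
    simp only [map_mul]
    ring
  · let P : (RatFunc ℚ)[X] := X ^ 2 - C (algebraMap ℚ[X] (RatFunc ℚ) f)
    have hirr : Irreducible P := by
      rw [X_pow_sub_C_irreducible_iff_of_prime Nat.prime_two]
      exact hnsq
    have : Fact (Irreducible P) := ⟨hirr⟩
    have e1 : P.eval₂ (algebraMap (RatFunc ℚ) F) y = 0 := by simp [P, hy]
    have e2 : P.eval₂ (algebraMap (RatFunc ℚ) F) (-y) = 0 := by simp [P, hy]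
    let φ := AdjoinRoot.lift (algebraMap (RatFunc ℚ) F) y e1
    let ψ := AdjoinRoot.lift (algebraMap (RatFunc ℚ) F) (-y) e2
    have hbij : Function.Bijective φ := by
      refine ⟨φ.injective, fun g => ?_⟩
      obtain ⟨A, B, rfl⟩ := gen g
      refine ⟨AdjoinRoot.of P A + AdjoinRoot.of P B * AdjoinRoot.root P, ?_⟩
      simp [φ]
    let e := RingEquiv.ofBijective φ hbij
    refine ⟨ψ.comp e.symm.toRingHom, ?_, ?_⟩
    · have : e.symm (algebraMap (RatFunc ℚ) F RatFunc.X) = AdjoinRoot.of P RatFunc.X := by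
        rw [RingEquiv.symm_apply_eq]
        exact (AdjoinRoot.lift_of e1).symm
      change ψ (e.symm _) = _
      rw [this]
      exact AdjoinRoot.lift_of e2
    · have : e.symm y = AdjoinRoot.root P := by
        rw [RingEquiv.symm_apply_eq]
        exact (AdjoinRoot.lift_root e1).symm
      change ψ (e.symm _) = _
      rw [this]
      exact AdjoinRoot.lift_root e2

lemma alg_C [CharZero F] (c : ℚ) : algebraMap (RatFunc ℚ) F (RatFunc.C c) = (c : F) :=
  eq_ratCast ((algebraMap (RatFunc ℚ) F).comp RatFunc.C) c

lemma place_iff [CharZero F] (v : AddValuation F (WithTop ℤ)) : IsCurvePlace F v ↔ Pl F v := by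
  simp only [IsCurvePlace, Pl, alg_C]

end Final

theorem stmt12 (a b : ℚ) (hb : b ≠ 0) (hab : a ^ 2 ≠ 4 * b ^ 2)
    (F : Type) [Field F] [Algebra (RatFunc ℚ) F]
    (y : F)
    (hy : y ^ 2 = algebraMap (RatFunc ℚ) F
      (RatFunc.X ^ 6 + RatFunc.C a * RatFunc.X ^ 3 + RatFunc.C b ^ 2))
    (hgen : Algebra.adjoin (RatFunc ℚ) {y} = ⊤) :
    ∃ D₁ D₂ : ({v : AddValuation F (WithTop ℤ) // IsCurvePlace F v} →₀ ℤ),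
      (∀ v : {v : AddValuation F (WithTop ℤ) // IsCurvePlace F v},
        v.1 (y - algebraMap (RatFunc ℚ) F (RatFunc.X ^ 3 + RatFunc.C b))
          = ((3 * D₁ v : ℤ) : WithTop ℤ)) ∧
      (∀ v : {v : AddValuation F (WithTop ℤ) // IsCurvePlace F v},
        v.1 (y - algebraMap (RatFunc ℚ) F (RatFunc.X ^ 3 - RatFunc.C b))
          = ((3 * D₂ v : ℤ) : WithTop ℤ)) ∧
      (∀ m n : ℤ, m • D₁ + n • D₂ ∈
          AddSubgroup.closure {D : {v : AddValuation F (WithTop ℤ) // IsCurvePlace F v} →₀ ℤ |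
            ∃ g : Fˣ, ∀ v : {v : AddValuation F (WithTop ℤ) // IsCurvePlace F v},
              ((D v : ℤ) : WithTop ℤ) = v.1 (g : F)} →
        (3 ∣ m ∧ 3 ∣ n)) := by
  have : CharZero F := charZero_of_injective_ringHom
    ((algebraMap (RatFunc ℚ) F).comp (algebraMap ℚ (RatFunc ℚ))).injective
  have H := mkQC hb hab y (by
    rw [hy]
    congr 1
    simp [RatFunc.algebraMap_X, RatFunc.algebraMap_C]) hgen
  simp only [map_add, map_sub, map_pow, map_mul, alg_C] at hy ⊢
  generalize algebraMap (RatFunc ℚ) F RatFunc.X = t at *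
  have h1 : a - 2 * b ≠ 0 := fun h => hab (by linear_combination (a + 2 * b) * h)
  have h2 : a + 2 * b ≠ 0 := fun h => hab (by linear_combination (a - 2 * b) * h)
  have ht0 := H.t_ne
  have J := fun v (hv : Pl F v) => ord_joint hb h1 h2 ht0 hy hv
  have Hi := H.inv
  have hinf : ∃ v, Pl F v ∧ ordv v t < 0 := by
    obtain ⟨v, hv, h⟩ := Hi.exists_place
    rw [ordv_inv] at h
    exact ⟨v, hv, by omega⟩
  have fin : {v | Pl F v ∧ ordv v t ≠ 0}.Finite := by
    refine ((H.finite hb (by simp [coeff_X_pow, coeff_zero_eq_eval_zero])).union (Hi.finite one_ne_zero (by simp [coeff_X_pow]))).subset ?_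
    rintro v ⟨hv, h⟩
    rcases lt_or_gt_of_ne h with h | h
    · exact Or.inr ⟨hv, by rw [ordv_inv]; omega⟩
    · exact Or.inl ⟨hv, h⟩
  have fin' : {v : {v : AddValuation F (WithTop ℤ) // IsCurvePlace F v} | ordv v.1 t ≠ 0}.Finite := by
    refine Set.Finite.of_finite_image (f := Subtype.val) (fin.subset ?_) Subtype.val_injective.injOn
    rintro _ ⟨v, hv, rfl⟩
    exact ⟨(place_iff _).1 v.2, hv⟩
  let D₁ : ({v : AddValuation F (WithTop ℤ) // IsCurvePlace F v} →₀ ℤ) :=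
    Finsupp.ofSupportFinite (fun v => ordv v.1 (y - (t ^ 3 + b)) / 3) (by
      refine fin'.subset fun v hv => ?_
      intro h0
      apply hv
      obtain ⟨-, -, j1, j2, -⟩ := J v.1 ((place_iff _).1 v.2)
      change ordv v.1 (y - (t ^ 3 + b)) / 3 = 0
      omega)
  let D₂ : ({v : AddValuation F (WithTop ℤ) // IsCurvePlace F v} →₀ ℤ) :=
    Finsupp.ofSupportFinite (fun v => ordv v.1 (y - (t ^ 3 - b)) / 3) (by
      refine fin'.subset fun v hv => ?_
      intro h0
      apply hv
      obtain ⟨-, -, j1, j2, -⟩ := J v.1 ((place_iff _).1 v.2)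
      change ordv v.1 (y - (t ^ 3 - b)) / 3 = 0
      omega)
  have hD₁ : ∀ v, 3 * D₁ v = ordv v.1 (y - (t ^ 3 + b)) := by
    intro v
    obtain ⟨-, -, j1, j2, -⟩ := J v.1 ((place_iff _).1 v.2)
    change 3 * (ordv v.1 (y - (t ^ 3 + b)) / 3) = _
    omega
  have hD₂ : ∀ v, 3 * D₂ v = ordv v.1 (y - (t ^ 3 - b)) := by
    intro v
    obtain ⟨-, -, j1, j2, -⟩ := J v.1 ((place_iff _).1 v.2)
    change 3 * (ordv v.1 (y - (t ^ 3 - b)) / 3) = _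
    omega
  refine ⟨D₁, D₂, ?_, ?_, ?_⟩
  · intro v
    rw [hD₁, ← ordv_spec]
    exact (J v.1 ((place_iff _).1 v.2)).1
  · intro v
    rw [hD₂, ← ordv_spec]
    exact (J v.1 ((place_iff _).1 v.2)).2.1
  · intro m n hmem
    have key : ∃ g : F, g ≠ 0 ∧ ∀ v : {v : AddValuation F (WithTop ℤ) // IsCurvePlace F v}, 
        (m • D₁ + n • D₂) v = ordv v.1 g := by
      generalize m • D₁ + n • D₂ = D at hmem
      induction hmem using AddSubgroup.closure_induction with
      | mem D hD =>
        obtain ⟨g, hg⟩ := hD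
        exact ⟨g, g.ne_zero, fun v => (ordv_eq _ (hg v).symm).symm⟩
      | zero => exact ⟨1, one_ne_zero, fun v => by simp [ordv_one]⟩
      | add D E _ _ hD hE =>
        obtain ⟨g, hg, hg'⟩ := hD
        obtain ⟨h, hh, hh'⟩ := hE
        exact ⟨g * h, mul_ne_zero hg hh, fun v => by
          rw [ordv_mul _ hg hh, ← hg', ← hh', Finsupp.add_apply]⟩
      | neg D _ hD =>
        obtain ⟨g, hg, hg'⟩ := hD
        exact ⟨g⁻¹, inv_ne_zero hg, fun v => by rw [ordv_inv, ← hg', Finsupp.neg_apply]⟩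
    obtain ⟨g, hg, hg'⟩ := key
    refine core2 H (f_sqfree hb hab) (f_deg a b) hinf hb h1 h2 hy g hg m n ?_
    intro v hv
    have := hg' ⟨v, (place_iff v).2 hv⟩
    have k1 := hD₁ ⟨v, (place_iff v).2 hv⟩
    have k2 := hD₂ ⟨v, (place_iff v).2 hv⟩
    simp only [Finsupp.add_apply, Finsupp.smul_apply, smul_eq_mul] at this k1 k2
    rw [← this, ← k1, ← k2]
    ring
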